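/- arXiv:1904.03336 — 9 statements merged into one kernel-verified Lean document; each statement's English description precedes it below -/
import Mathlib

section
/- Let D be a quantitative database over a finite set of items I, let X ⊆ I be a nonempty itemset such that sup({i}) > 0 for every i ∈ X, and let a ∈ I \ X be an item with sup({a}) > 0 such that sup({i}) ≤ sup({a}) for every i ∈ X. Then Kulc(X ∪ {a}) ≤ Kulc(X). (Sorted downward closure property of the Kulc measure: appending an item whose support is at least the support of every item already in the pattern cannot increase the Kulc value.) -/
/-- The support of an itemset `X` in the quantitative database `D` with
quantity function `q` : number of transactions of `D` containing every item of `X`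
with positive quantity. -/
def supp {τ ι : Type*} (D : Finset τ) (q : τ → ι → ℕ) (X : Finset ι) : ℕ :=
  (D.filter (fun c => ∀ i ∈ X, 0 < q c i)).card

/-- The Kulczynski measure of an itemset `X`:
`Kulc(X) = (1/|X|) * Σ_{i ∈ X} sup(X) / sup({i})`. -/
noncomputable def kulc {τ ι : Type*} (D : Finset τ) (q : τ → ι → ℕ) (X : Finset ι) : ℝ :=
  (1 / (X.card : ℝ)) * ∑ i ∈ X, (supp D q X : ℝ) / (supp D q {i} : ℝ)

/-- Support is antitone: enlarging an itemset cannot increase its support. -/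
theorem supp_anti {τ ι : Type*} (D : Finset τ) (q : τ → ι → ℕ) {X Y : Finset ι} (h : X ⊆ Y) :
    supp D q Y ≤ supp D q X :=
  Finset.card_le_card (Finset.monotone_filter_right D fun _ _ hc i hi => hc i (h hi))

/-- The Kulczynski measure as the support times the mean reciprocal item support. -/
theorem kulc_eq_mul_sum_inv {τ ι : Type*} (D : Finset τ) (q : τ → ι → ℕ) (X : Finset ι) :
    kulc D q X = supp D q X * ((∑ i ∈ X, (supp D q {i} : ℝ)⁻¹) / X.card) := by
  simp only [kulc, div_eq_mul_inv, ← Finset.mul_sum]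
  ring

/-- Inserting a value not exceeding any of the averaged values cannot increase the mean. -/
theorem sum_insert_div_card_le {ι : Type*} [DecidableEq ι] {X : Finset ι} (hX : X.Nonempty)
    {a : ι} (ha : a ∉ X) {f : ι → ℝ} (hf : ∀ i ∈ X, f a ≤ f i) :
    (∑ i ∈ insert a X, f i) / (insert a X).card ≤ (∑ i ∈ X, f i) / X.card := by
  have hk : (0 : ℝ) < X.card := by exact_mod_cast hX.card_pos
  have hsum : (X.card : ℝ) * f a ≤ ∑ i ∈ X, f i := by
    simpa using X.card_nsmul_le_sum f (f a) hf
  rw [Finset.sum_insert ha, Finset.card_insert_of_notMem ha, Nat.cast_add_one,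
    div_le_div_iff₀ (by positivity) hk]
  linarith

/-- Sorted downward closure property of the Kulc measure: appending an item `a`
whose support is at least the support of every item already in the nonempty
pattern `X` cannot increase the Kulc value. -/
theorem kulc_sorted_downward_closure {τ ι : Type*} [DecidableEq ι]
    (D : Finset τ) (q : τ → ι → ℕ) (X : Finset ι) (hX : X.Nonempty)
    (hpos : ∀ i ∈ X, 0 < supp D q {i})
    (a : ι) (ha : a ∉ X) (hapos : 0 < supp D q {a})
    (hle : ∀ i ∈ X, supp D q {i} ≤ supp D q {a}) :
    kulc D q (insert a X) ≤ kulc D q X := by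
  rw [kulc_eq_mul_sum_inv, kulc_eq_mul_sum_inv]
  gcongr ?_ * ?_
  · exact_mod_cast supp_anti D q (Finset.subset_insert a X)
  · refine sum_insert_div_card_le hX ha fun i hi => ?_
    exact inv_anti₀ (by exact_mod_cast hpos i hi) (by exact_mod_cast hle i hi)
end

section
/- The Kulc measure is null-transaction invariant: let D be a quantitative database over a finite set of items I, let X ⊆ I be a nonempty itemset with sup({i}) > 0 for every i ∈ X, and let c₀ ∉ D be a new transaction identifier whose quantity function satisfies q(c₀,i) = 0 for every i ∈ X. Then the Kulc value of X computed in the enlarged database D ∪ {c₀} equals the Kulc value of X computed in D. -/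
/-- A transaction missing some item of `Y` does not contribute to the support of `Y`. -/
theorem supp_insert_of_exists_eq_zero {τ ι : Type*} [DecidableEq τ] (D : Finset τ)
    (q : τ → ι → ℕ) {Y : Finset ι} {c : τ} (h : ∃ i ∈ Y, q c i = 0) :
    supp (insert c D) q Y = supp D q Y := by
  obtain ⟨i, hi, hq⟩ := h
  have hc : ¬ ∀ i ∈ Y, 0 < q c i := fun hY => (hY i hi).ne' hq
  rw [supp, supp, Finset.filter_insert, if_neg hc]

/-- The Kulc measure is null-transaction invariant: adding a new transaction
`c₀` containing no item of `X` does not change the Kulc value of `X`. -/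
theorem kulc_null_transaction_invariant {τ ι : Type*} [DecidableEq τ]
    (D : Finset τ) (q : τ → ι → ℕ) (X : Finset ι) (hX : X.Nonempty)
    (hpos : ∀ i ∈ X, 0 < supp D q {i})
    (c₀ : τ) (hc₀ : c₀ ∉ D) (hnull : ∀ i ∈ X, q c₀ i = 0) :
    kulc (insert c₀ D) q X = kulc D q X := by
  obtain ⟨j, hj⟩ := hX
  have hsupp : supp (insert c₀ D) q X = supp D q X :=
    supp_insert_of_exists_eq_zero D q ⟨j, hj, hnull j hj⟩
  rw [kulc, kulc, hsupp]
  congr 1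
  refine Finset.sum_congr rfl fun i hi => ?_
  rw [supp_insert_of_exists_eq_zero D q ⟨i, Finset.mem_singleton_self i, hnull i hi⟩]
end

section
/- Let D be a quantitative database over a finite set of items I with nonnegative unit profits. Then for every itemset X ⊆ I, u(X) ≤ TWU(X); that is, the transaction-weighted utilization overestimates the total utility of every pattern, so pruning by TWU misses no high-utility pattern. -/
/-- The utility of an itemset `X` in a transaction `c`:
`u(X,c) = Σ_{i ∈ X} pr(i) * q(c,i)`. -/
def setUtil {τ ι : Type*} (q : τ → ι → ℕ) (pr : ι → ℝ) (X : Finset ι) (c : τ) : ℝ :=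
  ∑ i ∈ X, pr i * (q c i : ℝ)

/-- The total utility of an itemset `X` in a database `D`:
the sum of `u(X,c)` over the transactions `c ∈ D` containing `X`. -/
def totalUtil {τ ι : Type*} (D : Finset τ) (q : τ → ι → ℕ) (pr : ι → ℝ)
    (X : Finset ι) : ℝ :=
  ∑ c ∈ D.filter (fun c => ∀ i ∈ X, 0 < q c i), setUtil q pr X c

/-- The transaction utility of a transaction `c`:
`tu(c) = Σ_{i ∈ T_c} pr(i) * q(c,i)`. -/
def tu {τ ι : Type*} [Fintype ι] (q : τ → ι → ℕ) (pr : ι → ℝ) (c : τ) : ℝ :=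
  ∑ i ∈ Finset.univ.filter (fun i => 0 < q c i), pr i * (q c i : ℝ)

/-- The transaction-weighted utilization of an itemset `X`:
the sum of the transaction utilities of the transactions containing `X`. -/
def twu {τ ι : Type*} [Fintype ι] (D : Finset τ) (q : τ → ι → ℕ) (pr : ι → ℝ)
    (X : Finset ι) : ℝ :=
  ∑ c ∈ D.filter (fun c => ∀ i ∈ X, 0 < q c i), tu q pr c

/-- `TWU` overestimates the total utility of every pattern:
`u(X) ≤ TWU(X)` for every itemset `X`. -/
theorem totalUtil_le_twu {τ ι : Type*} [Fintype ι]
    (D : Finset τ) (q : τ → ι → ℕ) (pr : ι → ℝ) (hpr : ∀ i, 0 ≤ pr i)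
    (X : Finset ι) :
    totalUtil D q pr X ≤ twu D q pr X := by
  refine Finset.sum_le_sum fun c hc => ?_
  have hX := (Finset.mem_filter.mp hc).2
  exact Finset.sum_le_sum_of_subset_of_nonneg
    (fun i hi => Finset.mem_filter.mpr ⟨Finset.mem_univ i, hX i hi⟩)
    (fun i _ _ => mul_nonneg (hpr i) (Nat.cast_nonneg _))
end

section
/- Let D be a quantitative database over a finite set of items I with nonnegative unit profits. Then the transaction-weighted utilization is anti-monotone: for all itemsets X ⊆ Y ⊆ I, TWU(Y) ≤ TWU(X). Consequently, for any threshold δ ≥ 0, if TWU(X) < δ then TWU(Y) < δ for every superset Y of X. -/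
theorem tu_nonneg {τ ι : Type*} [Fintype ι] (q : τ → ι → ℕ) {pr : ι → ℝ}
    (hpr : ∀ i, 0 ≤ pr i) (c : τ) : 0 ≤ tu q pr c :=
  Finset.sum_nonneg fun i _ => mul_nonneg (hpr i) (Nat.cast_nonneg _)

theorem twu_le_twu_of_subset {τ ι : Type*} [Fintype ι] (D : Finset τ) (q : τ → ι → ℕ)
    {pr : ι → ℝ} (hpr : ∀ i, 0 ≤ pr i) {X Y : Finset ι} (hXY : X ⊆ Y) :
    twu D q pr Y ≤ twu D q pr X :=
  Finset.sum_le_sum_of_subset_of_nonneg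
    (Finset.monotone_filter_right D fun _ _ h i hi => h i (hXY hi))
    fun c _ _ => tu_nonneg q hpr c

/-- Anti-monotonicity of the transaction-weighted utilization: for itemsets
`X ⊆ Y`, `TWU(Y) ≤ TWU(X)`; consequently, for any threshold `δ ≥ 0`, if
`TWU(X) < δ` then `TWU(Y) < δ`. -/
theorem twu_anti_monotone {τ ι : Type*} [Fintype ι]
    (D : Finset τ) (q : τ → ι → ℕ) (pr : ι → ℝ) (hpr : ∀ i, 0 ≤ pr i)
    (X Y : Finset ι) (hXY : X ⊆ Y) :
    twu D q pr Y ≤ twu D q pr X ∧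
      ∀ δ : ℝ, 0 ≤ δ → twu D q pr X < δ → twu D q pr Y < δ :=
  have h := twu_le_twu_of_subset D q hpr hXY
  ⟨h, fun _ _ hX => h.trans_lt hX⟩
end

section
/- Let D be a quantitative database over a finite set of items I with nonnegative unit profits, fix a strict total order ≺ on I, let X' be an extension of an itemset X, and let c ∈ D be a transaction with X' ⊆ T_c. Then u(X',c) ≤ u(X,c) + ru(X,c): in each supporting transaction, the utility of any extension of X is at most the utility of X plus the remaining utility of X in that transaction. -/
/-- The remaining utility of `X` in transaction `c`: the sum of the utilities
of the items of `T_c` that are not in `X` and come after every item of `X` in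
the fixed strict total order on items. -/
def ru {τ ι : Type*} [Fintype ι] [LinearOrder ι] (q : τ → ι → ℕ) (pr : ι → ℝ)
    (X : Finset ι) (c : τ) : ℝ :=
  ∑ i ∈ Finset.univ.filter (fun i => 0 < q c i ∧ i ∉ X ∧ ∀ x ∈ X, x < i),
    pr i * (q c i : ℝ)

/-- The total remaining utility of `X`: the sum of `ru(X,c)` over the
transactions `c ∈ D` containing `X`. -/
def totalRU {τ ι : Type*} [Fintype ι] [LinearOrder ι] (D : Finset τ)
    (q : τ → ι → ℕ) (pr : ι → ℝ) (X : Finset ι) : ℝ :=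
  ∑ c ∈ D.filter (fun c => ∀ i ∈ X, 0 < q c i), ru q pr X c

/-- `X'` is an extension of `X` if `X ⊆ X'` and every item of `X' \ X` comes
after every item of `X` in the fixed strict total order on items. -/
def IsExtension {ι : Type*} [LinearOrder ι] (X X' : Finset ι) : Prop :=
  X ⊆ X' ∧ ∀ x ∈ X, ∀ a ∈ X' \ X, x < a

/-- In each supporting transaction, the utility of any extension `X'` of `X`
is at most the utility of `X` plus the remaining utility of `X`:
`u(X',c) ≤ u(X,c) + ru(X,c)`. -/
theorem setUtil_extension_le {τ ι : Type*} [Fintype ι] [LinearOrder ι]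
    (D : Finset τ) (q : τ → ι → ℕ) (pr : ι → ℝ) (hpr : ∀ i, 0 ≤ pr i)
    (X X' : Finset ι) (hext : IsExtension X X')
    (c : τ) (hc : c ∈ D) (hcon : ∀ i ∈ X', 0 < q c i) :
    setUtil q pr X' c ≤ setUtil q pr X c + ru q pr X c := by
  obtain ⟨hsub, hlt⟩ := hext
  unfold setUtil ru
  rw [← Finset.sum_sdiff hsub, add_comm]
  refine add_le_add le_rfl ?_
  refine Finset.sum_le_sum_of_subset_of_nonneg ?_ fun i _ _ =>
    mul_nonneg (hpr i) (Nat.cast_nonneg _)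
  intro a ha
  have ha' := Finset.mem_sdiff.mp ha
  exact Finset.mem_filter.mpr
    ⟨Finset.mem_univ a, hcon a ha'.1, ha'.2, fun x hx => hlt x hx a ha⟩
end

section
/- Upper bound on utility: let D be a quantitative database over a finite set of items I with nonnegative unit profits, fix a strict total order ≺ on I, and let X' be an extension of an itemset X. Then u(X') ≤ u(X) + RU(X); that is, the sum of the total utility and total remaining utility of X is an upper bound on the total utility of every extension of X. -/
theorem setUtil_nonneg {τ ι : Type*} (q : τ → ι → ℕ) {pr : ι → ℝ} (hpr : ∀ i, 0 ≤ pr i)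
    (X : Finset ι) (c : τ) : 0 ≤ setUtil q pr X c :=
  Finset.sum_nonneg fun i _ => mul_nonneg (hpr i) (Nat.cast_nonneg _)

theorem ru_nonneg {τ ι : Type*} [Fintype ι] [LinearOrder ι] (q : τ → ι → ℕ) {pr : ι → ℝ}
    (hpr : ∀ i, 0 ≤ pr i) (X : Finset ι) (c : τ) : 0 ≤ ru q pr X c :=
  setUtil_nonneg q hpr _ c

/-- In a transaction containing an extension `X'` of `X`, the utility of `X'` is at most the
utility of `X` plus its remaining utility. -/
theorem setUtil_le_setUtil_add_ru {τ ι : Type*} [Fintype ι] [LinearOrder ι]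
    {q : τ → ι → ℕ} {pr : ι → ℝ} (hpr : ∀ i, 0 ≤ pr i) {X X' : Finset ι}
    (hext : IsExtension X X') {c : τ} (hc : ∀ i ∈ X', 0 < q c i) :
    setUtil q pr X' c ≤ setUtil q pr X c + ru q pr X c := by
  obtain ⟨hsub, hlt⟩ := hext
  unfold setUtil ru
  rw [← Finset.sum_sdiff hsub, add_comm]
  refine add_le_add_right ?_ _
  refine Finset.sum_le_sum_of_subset_of_nonneg (fun i hi => ?_)
    fun i _ _ => mul_nonneg (hpr i) (Nat.cast_nonneg _)
  obtain ⟨hi', hiX⟩ := Finset.mem_sdiff.1 hi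
  exact Finset.mem_filter.2 ⟨Finset.mem_univ i, hc i hi', hiX, fun x hx => hlt x hx i hi⟩

theorem totalUtil_add_totalRU {τ ι : Type*} [Fintype ι] [LinearOrder ι]
    (D : Finset τ) (q : τ → ι → ℕ) (pr : ι → ℝ) (X : Finset ι) :
    totalUtil D q pr X + totalRU D q pr X =
      ∑ c ∈ D.filter (fun c => ∀ i ∈ X, 0 < q c i), (setUtil q pr X c + ru q pr X c) := by
  rw [Finset.sum_add_distrib]
  unfold totalUtil totalRU
  congr!

/-- Upper bound on utility: the total utility of any extension `X'` of `X`
is at most `u(X) + RU(X)`. -/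
theorem totalUtil_extension_le {τ ι : Type*} [Fintype ι] [LinearOrder ι]
    (D : Finset τ) (q : τ → ι → ℕ) (pr : ι → ℝ) (hpr : ∀ i, 0 ≤ pr i)
    (X X' : Finset ι) (hext : IsExtension X X') :
    totalUtil D q pr X' ≤ totalUtil D q pr X + totalRU D q pr X := by
  rw [totalUtil_add_totalRU]
  refine (Finset.sum_le_sum fun c hc => setUtil_le_setUtil_add_ru hpr hext ?_).trans
    (Finset.sum_le_sum_of_subset_of_nonneg (fun c hc => ?_)
      fun c _ _ => add_nonneg (setUtil_nonneg q hpr X c) (ru_nonneg q hpr X c))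
  · simp only [Finset.mem_filter] at hc
    exact hc.2
  · simp only [Finset.mem_filter] at hc ⊢
    exact ⟨hc.1, fun i hi => hc.2 i (hext.1 hi)⟩
end

section
/- Let D be a quantitative database over a finite set of items I with nonnegative unit profits, fix a strict total order ≺ on I, let X' be an extension of an itemset X, and let c ∈ D be a transaction with X' ⊆ T_c. Then u(X',c) + ru(X',c) ≤ u(X,c) + ru(X,c). -/
/-- In each supporting transaction, `u(X',c) + ru(X',c) ≤ u(X,c) + ru(X,c)`
for any extension `X'` of `X`. -/
theorem setUtil_add_ru_extension_le {τ ι : Type*} [Fintype ι] [LinearOrder ι]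
    (D : Finset τ) (q : τ → ι → ℕ) (pr : ι → ℝ) (hpr : ∀ i, 0 ≤ pr i)
    (X X' : Finset ι) (hext : IsExtension X X')
    (c : τ) (hc : c ∈ D) (hcon : ∀ i ∈ X', 0 < q c i) :
    setUtil q pr X' c + ru q pr X' c ≤ setUtil q pr X c + ru q pr X c := by
  obtain ⟨hsub, hlt⟩ := hext
  unfold setUtil ru
  rw [← Finset.sum_union, ← Finset.sum_union]
  · refine Finset.sum_le_sum_of_subset_of_nonneg ?_
      fun i _ _ => mul_nonneg (hpr i) (Nat.cast_nonneg _)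
    intro i hi
    by_cases hiX : i ∈ X
    · exact Finset.mem_union_left _ hiX
    · refine Finset.mem_union_right _ (Finset.mem_filter.2 ⟨Finset.mem_univ i, ?_⟩)
      rcases Finset.mem_union.1 hi with h | h
      · exact ⟨hcon i h, hiX, fun x hx => hlt x hx i (Finset.mem_sdiff.2 ⟨h, hiX⟩)⟩
      · obtain ⟨-, hq, -, hgt⟩ := Finset.mem_filter.1 h
        exact ⟨hq, hiX, fun x hx => hgt x (hsub hx)⟩
  all_goals exact Finset.disjoint_right.2 fun i hi => (Finset.mem_filter.1 hi).2.2.1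
end

section
/- Remaining utility in the utility-list join: let D be a quantitative database over a finite set of items I, fix a strict total order ≺ on I, let X ⊆ I be an itemset, and let a, b ∈ I \ X be items with x ≺ a for every x ∈ X and a ≺ b. Then for every transaction c ∈ D with X ∪ {a,b} ⊆ T_c, ru(X ∪ {a,b}, c) = ru(X ∪ {b}, c). -/
/-- Remaining utility in the utility-list join: if every item of `X` precedes
`a` and `a ≺ b`, then in every transaction `c ∈ D` containing `X ∪ {a, b}`,
`ru(X ∪ {a,b}, c) = ru(X ∪ {b}, c)`. -/
theorem ru_utility_list_join {τ ι : Type*} [Fintype ι] [LinearOrder ι]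
    (D : Finset τ) (q : τ → ι → ℕ) (pr : ι → ℝ) (hpr : ∀ i, 0 ≤ pr i)
    (X : Finset ι) (a b : ι) (ha : a ∉ X) (hb : b ∉ X)
    (hXa : ∀ x ∈ X, x < a) (hab : a < b)
    (c : τ) (hc : c ∈ D) (hcon : ∀ i ∈ insert a (insert b X), 0 < q c i) :
    ru q pr (insert a (insert b X)) c = ru q pr (insert b X) c := by
  unfold ru
  congr 1
  ext i
  simp only [Finset.mem_filter, Finset.mem_univ, true_and, Finset.mem_insert, not_or,
    forall_eq_or_imp]
  constructor
  · rintro ⟨hq, ⟨-, hib, hiX⟩, -, hbi, hXi⟩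
    exact ⟨hq, ⟨hib, hiX⟩, hbi, hXi⟩
  · rintro ⟨hq, ⟨hib, hiX⟩, hbi, hXi⟩
    have hai : a < i := hab.trans hbi
    exact ⟨hq, ⟨hai.ne', hib, hiX⟩, hai, hbi, hXi⟩
end

section
/- The Kulc measure is neither monotonic nor anti-monotonic in general (without the support-ascending ordering assumption): there exist a quantitative database D₁ over a finite set of items and nonempty itemsets X₁ ⊆ Y₁, with every singleton subset having positive support, such that Kulc(X₁) < Kulc(Y₁); and there exist a quantitative database D₂ and nonempty itemsets X₂ ⊆ Y₂, with every singleton subset having positive support, such that Kulc(X₂) > Kulc(Y₂). -/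
/-- The quantities in a database of three transactions over three items, whose
transactions support the itemsets `{0, 1, 2}`, `{0}` and `{1}`. -/
def kulcExampleQuantity (c i : Fin 3) : ℕ :=
  !![1, 1, 1; 1, 0, 0; 0, 1, 0] c i

lemma supp_kulcExampleQuantity_singleton (i : Fin 3) :
    supp Finset.univ kulcExampleQuantity {i} = ![2, 2, 1] i := by
  revert i
  decide

lemma kulc_kulcExampleQuantity_zero :
    kulc Finset.univ kulcExampleQuantity {0} = 1 := by
  simp [kulc, supp_kulcExampleQuantity_singleton]

lemma kulc_kulcExampleQuantity_pair :
    kulc Finset.univ kulcExampleQuantity {0, 1} = 1 / 2 := by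
  have h : supp Finset.univ kulcExampleQuantity {0, 1} = 1 := by decide
  norm_num [kulc, h, supp_kulcExampleQuantity_singleton]

lemma kulc_kulcExampleQuantity_univ :
    kulc Finset.univ kulcExampleQuantity Finset.univ = 2 / 3 := by
  have h : supp Finset.univ kulcExampleQuantity Finset.univ = 1 := by decide
  have h₂ : ![2, 2, 1] (2 : Fin 3) = 1 := rfl
  norm_num [kulc, h, h₂, supp_kulcExampleQuantity_singleton, Fin.sum_univ_three]

/-- The Kulc measure is neither monotonic nor anti-monotonic in general: there
is a quantitative database (over a finite set of items) with nonempty itemsets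
`X₁ ⊆ Y₁`, all of whose singleton subsets have positive support, such that
`Kulc(X₁) < Kulc(Y₁)`, and another one with nonempty itemsets `X₂ ⊆ Y₂`,
all singleton supports positive, such that `Kulc(X₂) > Kulc(Y₂)`. -/
theorem kulc_neither_monotone_nor_antimonotone :
    (∃ (ι τ : Type) (_ : Fintype ι) (D : Finset τ) (q : τ → ι → ℕ)
        (X Y : Finset ι),
      X.Nonempty ∧ Y.Nonempty ∧ X ⊆ Y ∧ (∀ i ∈ Y, 0 < supp D q {i}) ∧
        kulc D q X < kulc D q Y) ∧
    (∃ (ι τ : Type) (_ : Fintype ι) (D : Finset τ) (q : τ → ι → ℕ)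
        (X Y : Finset ι),
      X.Nonempty ∧ Y.Nonempty ∧ X ⊆ Y ∧ (∀ i ∈ Y, 0 < supp D q {i}) ∧
        kulc D q Y < kulc D q X) := by
  refine ⟨⟨Fin 3, Fin 3, inferInstance, Finset.univ, kulcExampleQuantity, {0, 1}, Finset.univ,
      by simp, by simp, by simp, by decide, ?_⟩,
    ⟨Fin 3, Fin 3, inferInstance, Finset.univ, kulcExampleQuantity, {0}, {0, 1},
      by simp, by simp, by simp, by decide, ?_⟩⟩
  · norm_num [kulc_kulcExampleQuantity_pair, kulc_kulcExampleQuantity_univ]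
  · norm_num [kulc_kulcExampleQuantity_zero, kulc_kulcExampleQuantity_pair]
end
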